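/- arXiv:1611.05442 — 11 statements merged into one kernel-verified Lean document; each statement's English description precedes it below -/
import Mathlib

section
/- Let A, B, C, D be complex matrices of sizes m×n, m×p, s×n, s×p respectively, and let A⁺, B⁺, C⁺, D⁺ denote their Moore-Penrose inverses. If D − C A⁺ B = 0 and A − B D⁺ C = 0, then the reverse order law (B D⁺ C)⁺ = C⁺ D B⁺ holds. -/
open Matrix

/-- `X` is the Moore-Penrose inverse of `A`. -/
def IsMoorePenrose {m n : Type*} [Fintype m] [Fintype n]
    (A : Matrix m n ℂ) (X : Matrix n m ℂ) : Prop :=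
  A * X * A = A ∧ X * A * X = X ∧ (A * X)ᴴ = A * X ∧ (X * A)ᴴ = X * A

namespace IsMoorePenrose

variable {m n : Type*} [Fintype m] [Fintype n]
  {A : Matrix m n ℂ} {X : Matrix n m ℂ}

/-- A Hermitian matrix fixing `A` from the right fixes its Moore-Penrose inverse from the left. -/
theorem hermitian_mul_eq (h : IsMoorePenrose A X) {P : Matrix n n ℂ}
    (hP : Pᴴ = P) (hAP : A * P = A) : P * X = X := by
  obtain ⟨-, hXAX, -, hXA⟩ := h
  have hPXA : P * (X * A) = X * A := by
    have := congrArg conjTranspose (show X * A * P = X * A by rw [Matrix.mul_assoc, hAP])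
    rwa [conjTranspose_mul, hP, hXA] at this
  calc P * X = P * (X * A) * X := by rw [Matrix.mul_assoc, hXAX]
    _ = X := by rw [hPXA, hXAX]

/-- A Hermitian matrix fixing `A` from the left fixes its Moore-Penrose inverse from the right. -/
theorem mul_hermitian_eq (h : IsMoorePenrose A X) {P : Matrix m m ℂ}
    (hP : Pᴴ = P) (hPA : P * A = A) : X * P = X := by
  obtain ⟨-, hXAX, hAX, -⟩ := h
  have hAXP : A * X * P = A * X := by
    have := congrArg conjTranspose (show P * (A * X) = A * X by rw [← Matrix.mul_assoc, hPA])
    rwa [conjTranspose_mul, hP, hAX] at this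
  calc X * P = X * (A * X * P) := by rw [← Matrix.mul_assoc, ← Matrix.mul_assoc, hXAX]
    _ = X := by rw [hAXP, ← Matrix.mul_assoc, hXAX]

end IsMoorePenrose

theorem vanishing_pseudo_schur_reverse_order_law_BDC {m n p s : ℕ}
    (A : Matrix (Fin m) (Fin n) ℂ) (B : Matrix (Fin m) (Fin p) ℂ)
    (C : Matrix (Fin s) (Fin n) ℂ) (D : Matrix (Fin s) (Fin p) ℂ)
    (Ap : Matrix (Fin n) (Fin m) ℂ) (Bp : Matrix (Fin p) (Fin m) ℂ)
    (Cp : Matrix (Fin n) (Fin s) ℂ) (Dp : Matrix (Fin p) (Fin s) ℂ)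
    (hA : IsMoorePenrose A Ap) (hB : IsMoorePenrose B Bp)
    (hC : IsMoorePenrose C Cp) (hD : IsMoorePenrose D Dp)
    (hF : D - C * Ap * B = 0) (hG : A - B * Dp * C = 0) :
    IsMoorePenrose (B * Dp * C) (Cp * D * Bp) := by
  have hA' : A = B * Dp * C := sub_eq_zero.mp hG
  have hD' : D = C * Ap * B := sub_eq_zero.mp hF
  have hAC : A * (Cp * C) = A := by
    rw [hA', Matrix.mul_assoc, ← Matrix.mul_assoc C, hC.1]
  have hBA : B * Bp * A = A := by
    rw [hA', ← Matrix.mul_assoc, ← Matrix.mul_assoc, hB.1]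
  have hX : Cp * D * Bp = Ap := by
    calc Cp * D * Bp = Cp * C * Ap * (B * Bp) := by
          rw [hD']
          simp only [Matrix.mul_assoc]
      _ = Ap := by
          rw [hA.hermitian_mul_eq hC.2.2.2 hAC, hA.mul_hermitian_eq hB.2.2.1 hBA]
  rwa [hX, ← hA']
end

section
/- Let A, B, C, D be complex matrices of sizes m×n, m×p, s×n, s×p respectively, and let A⁺, B⁺, C⁺, D⁺ denote their Moore-Penrose inverses. If D − C A⁺ B = 0 and A − B D⁺ C = 0, then the reverse order law (C A⁺ B)⁺ = B⁺ A C⁺ holds. -/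
open Matrix

theorem IsMoorePenrose.mul_left_eq_self_of_mul_eq_self {m n : Type*} [Fintype m] [Fintype n]
    {A : Matrix m n ℂ} {X : Matrix n m ℂ} (h : IsMoorePenrose A X)
    {P : Matrix n n ℂ} (hP : Pᴴ = P) (hAP : A * P = A) : P * X = X := by
  obtain ⟨-, hXAX, -, hXA⟩ := h
  have hPXA : P * (X * A) = X * A := by
    rw [← hXA, conjTranspose_mul, ← Matrix.mul_assoc]
    nth_rw 1 [← hP]
    rw [← conjTranspose_mul, hAP]
  rw [← hXAX, ← Matrix.mul_assoc, hPXA]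

theorem IsMoorePenrose.mul_right_eq_self_of_mul_eq_self {m n : Type*} [Fintype m] [Fintype n]
    {A : Matrix m n ℂ} {X : Matrix n m ℂ} (h : IsMoorePenrose A X)
    {Q : Matrix m m ℂ} (hQ : Qᴴ = Q) (hQA : Q * A = A) : X * Q = X := by
  obtain ⟨-, hXAX, hAX, -⟩ := h
  have hAXQ : A * X * Q = A * X := by
    rw [← hAX, conjTranspose_mul, Matrix.mul_assoc]
    nth_rw 1 [← hQ]
    rw [← conjTranspose_mul, hQA]
  rw [← hXAX, Matrix.mul_assoc X A X, Matrix.mul_assoc, hAXQ]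

theorem vanishing_pseudo_schur_reverse_order_law_CAB {m n p s : ℕ}
    (A : Matrix (Fin m) (Fin n) ℂ) (B : Matrix (Fin m) (Fin p) ℂ)
    (C : Matrix (Fin s) (Fin n) ℂ) (D : Matrix (Fin s) (Fin p) ℂ)
    (Ap : Matrix (Fin n) (Fin m) ℂ) (Bp : Matrix (Fin p) (Fin m) ℂ)
    (Cp : Matrix (Fin n) (Fin s) ℂ) (Dp : Matrix (Fin p) (Fin s) ℂ)
    (hA : IsMoorePenrose A Ap) (hB : IsMoorePenrose B Bp)
    (hC : IsMoorePenrose C Cp) (hD : IsMoorePenrose D Dp)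
    (hF : D - C * Ap * B = 0) (hG : A - B * Dp * C = 0) :
    IsMoorePenrose (C * Ap * B) (Bp * A * Cp) := by
  rw [sub_eq_zero] at hF hG
  have hDB : D * (Bp * B) = D := by
    rw [hF, Matrix.mul_assoc (C * Ap), ← Matrix.mul_assoc B, hB.1]
  have hCD : C * Cp * D = D := by
    rw [hF, Matrix.mul_assoc C Ap, ← Matrix.mul_assoc, hC.1]
  have hDp : Bp * A * Cp = Dp := calc
    Bp * A * Cp = Bp * B * Dp * (C * Cp) := by rw [hG]; simp only [Matrix.mul_assoc]
    _ = Dp := by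
      rw [hD.mul_left_eq_self_of_mul_eq_self hB.2.2.2 hDB,
        hD.mul_right_eq_self_of_mul_eq_self hC.2.2.1 hCD]
  rwa [hDp, ← hF]
end

section
/- Let A, B, C, D be complex matrices of sizes m×n, m×p, s×n, s×p respectively, with Moore-Penrose inverses A⁺, B⁺, C⁺, D⁺. Suppose the complementary pseudo Schur complement G = A − B D⁺ C equals 0. Then the pseudo Schur complement F = D − C A⁺ B equals 0 if and only if (I − C C⁺) D = 0, D (I − B⁺ B) = 0, and (B D⁺ C)⁺ = C⁺ D B⁺. -/
open Matrix

theorem IsMoorePenrose.unique {m n : Type*} [Fintype m] [Fintype n]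
    {A : Matrix m n ℂ} {X Y : Matrix n m ℂ}
    (hX : IsMoorePenrose A X) (hY : IsMoorePenrose A Y) : X = Y := by
  obtain ⟨x1, x2, x3, x4⟩ := hX
  obtain ⟨y1, y2, y3, y4⟩ := hY
  have left : A * X = A * Y := by
    calc A * X = (A * X)ᴴ := x3.symm
      _ = (A * Y * (A * X))ᴴ := by rw [← Matrix.mul_assoc, y1]
      _ = A * X * (A * Y) := by rw [conjTranspose_mul, x3, y3]
      _ = A * Y := by rw [← Matrix.mul_assoc, x1]
  have right : X * A = Y * A := by
    calc X * A = (X * A)ᴴ := x4.symm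
      _ = (X * A * (Y * A))ᴴ := by rw [Matrix.mul_assoc, ← Matrix.mul_assoc A, y1]
      _ = Y * A * (X * A) := by rw [conjTranspose_mul, x4, y4]
      _ = Y * A := by rw [Matrix.mul_assoc, ← Matrix.mul_assoc A, x1]
  calc X = X * A * X := x2.symm
    _ = Y * (A * X) := by rw [right, Matrix.mul_assoc]
    _ = Y := by rw [left, ← Matrix.mul_assoc, y2]

/-- A Hermitian matrix fixing `A` on the left fixes its Moore-Penrose inverse on the right. -/
theorem IsMoorePenrose.mul_eq_self_of_isHermitian {m n : Type*} [Fintype m] [Fintype n]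
    {A : Matrix m n ℂ} {X : Matrix n m ℂ} (h : IsMoorePenrose A X)
    {P : Matrix m m ℂ} (hP : P.IsHermitian) (hPA : P * A = A) : X * P = X := by
  obtain ⟨-, h2, h3, -⟩ := h
  have key : A * X * P = A * X := by
    rw [← h3, ← hP.eq, ← conjTranspose_mul, ← Matrix.mul_assoc, hPA]
  rw [← h2, Matrix.mul_assoc X, Matrix.mul_assoc X, key]

/-- A Hermitian matrix fixing `A` on the right fixes its Moore-Penrose inverse on the left. -/
theorem IsMoorePenrose.mul_eq_self_of_isHermitian_left {m n : Type*} [Fintype m] [Fintype n]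
    {A : Matrix m n ℂ} {X : Matrix n m ℂ} (h : IsMoorePenrose A X)
    {Q : Matrix n n ℂ} (hQ : Q.IsHermitian) (hAQ : A * Q = A) : Q * X = X := by
  obtain ⟨-, h2, -, h4⟩ := h
  have key : Q * (X * A) = X * A := by
    rw [← h4, ← hQ.eq, ← conjTranspose_mul, Matrix.mul_assoc, hAQ]
  rw [← h2, ← Matrix.mul_assoc, key]

theorem G_zero_implies_F_zero_characterization {m n p s : ℕ}
    (A : Matrix (Fin m) (Fin n) ℂ) (B : Matrix (Fin m) (Fin p) ℂ)
    (C : Matrix (Fin s) (Fin n) ℂ) (D : Matrix (Fin s) (Fin p) ℂ)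
    (Ap : Matrix (Fin n) (Fin m) ℂ) (Bp : Matrix (Fin p) (Fin m) ℂ)
    (Cp : Matrix (Fin n) (Fin s) ℂ) (Dp : Matrix (Fin p) (Fin s) ℂ)
    (hA : IsMoorePenrose A Ap) (hB : IsMoorePenrose B Bp)
    (hC : IsMoorePenrose C Cp) (hD : IsMoorePenrose D Dp)
    (hG : A - B * Dp * C = 0) :
    D - C * Ap * B = 0 ↔
      ((1 - C * Cp) * D = 0 ∧ D * (1 - Bp * B) = 0 ∧
        IsMoorePenrose (B * Dp * C) (Cp * D * Bp)) := by
  have hAeq : A = B * Dp * C := sub_eq_zero.mp hG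
  rw [← hAeq]
  constructor
  · intro hF
    have hDeq : D = C * Ap * B := sub_eq_zero.mp hF
    have hBA : B * Bp * A = A := by
      rw [hAeq, ← Matrix.mul_assoc, ← Matrix.mul_assoc, hB.1]
    have hAC : A * (Cp * C) = A := by
      rw [hAeq, Matrix.mul_assoc, ← Matrix.mul_assoc C, hC.1]
    have hX : Cp * D * Bp = Ap := by
      calc Cp * D * Bp = Cp * C * Ap * (B * Bp) := by rw [hDeq]; simp only [Matrix.mul_assoc]
        _ = Ap := by
          rw [hA.mul_eq_self_of_isHermitian_left hC.2.2.2 hAC,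
            hA.mul_eq_self_of_isHermitian hB.2.2.1 hBA]
    refine ⟨?_, ?_, hX ▸ hA⟩
    · rw [Matrix.sub_mul, Matrix.one_mul, sub_eq_zero, hDeq, ← Matrix.mul_assoc,
        ← Matrix.mul_assoc, hC.1]
    · rw [Matrix.mul_sub, Matrix.mul_one, sub_eq_zero, hDeq, Matrix.mul_assoc (C * Ap),
        ← Matrix.mul_assoc B, hB.1]
  · rintro ⟨hCD, hDB, hX⟩
    rw [Matrix.sub_mul, Matrix.one_mul, sub_eq_zero] at hCD
    rw [Matrix.mul_sub, Matrix.mul_one, sub_eq_zero] at hDB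
    rw [sub_eq_zero, hA.unique hX]
    calc D = C * Cp * D * (Bp * B) := by rw [← hCD, ← hDB]
      _ = C * (Cp * D * Bp) * B := by simp only [Matrix.mul_assoc]
end

section
/- Let A, B, C, D be complex matrices of sizes m×n, m×p, s×n, s×p respectively, with Moore-Penrose inverses A⁺, B⁺, C⁺, D⁺. Suppose the pseudo Schur complement F = D − C A⁺ B equals 0. Then the complementary pseudo Schur complement G = A − B D⁺ C equals 0 if and only if (I − B B⁺) A = 0, A (I − C⁺ C) = 0, and (C A⁺ B)⁺ = B⁺ A C⁺. -/
open Matrix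

namespace IsMoorePenrose

variable {m n : Type*} [Fintype m] [Fintype n]

/-- The Moore-Penrose inverse is unique. -/
theorem unique_s3 {A : Matrix m n ℂ} {X Y : Matrix n m ℂ}
    (hX : IsMoorePenrose A X) (hY : IsMoorePenrose A Y) : X = Y := by
  obtain ⟨x1, x2, x3, x4⟩ := hX
  obtain ⟨y1, y2, y3, y4⟩ := hY
  have hl : A * X = A * Y := by
    have h : (A * Y) * (A * X) = A * X := by rw [← Matrix.mul_assoc, y1]
    have h' := congrArg conjTranspose h
    rw [conjTranspose_mul, x3, y3, ← Matrix.mul_assoc, x1] at h'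
    exact h'.symm
  have hr : X * A = Y * A := by
    have h : (X * A) * (Y * A) = X * A := by
      rw [Matrix.mul_assoc, ← Matrix.mul_assoc A, y1]
    have h' := congrArg conjTranspose h
    rw [conjTranspose_mul, x4, y4, Matrix.mul_assoc, ← Matrix.mul_assoc A, x1] at h'
    exact h'.symm
  rw [← x2, Matrix.mul_assoc, hl, ← Matrix.mul_assoc, hr, y2]

/-- A Hermitian matrix fixing `D` from the right fixes the Moore-Penrose inverse of `D` from
the left. -/
theorem mul_eq_of_mul_eq {D : Matrix m n ℂ} {X : Matrix n m ℂ} (hX : IsMoorePenrose D X)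
    {P : Matrix n n ℂ} (hP : Pᴴ = P) (h : D * P = D) : P * X = X := by
  obtain ⟨-, x2, -, x4⟩ := hX
  have h1 : (X * D) * P = X * D := by rw [Matrix.mul_assoc, h]
  have h2 := congrArg conjTranspose h1
  rw [conjTranspose_mul, hP, x4] at h2
  rw [← x2, ← Matrix.mul_assoc, h2]

/-- A Hermitian matrix fixing `D` from the left fixes the Moore-Penrose inverse of `D` from
the right. -/
theorem eq_mul_of_eq_mul {D : Matrix m n ℂ} {X : Matrix n m ℂ} (hX : IsMoorePenrose D X)
    {Q : Matrix m m ℂ} (hQ : Qᴴ = Q) (h : Q * D = D) : X * Q = X := by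
  obtain ⟨-, x2, x3, -⟩ := hX
  have h1 : Q * (D * X) = D * X := by rw [← Matrix.mul_assoc, h]
  have h2 := congrArg conjTranspose h1
  rw [conjTranspose_mul, hQ, x3] at h2
  rw [← x2, Matrix.mul_assoc, Matrix.mul_assoc, ← Matrix.mul_assoc D, h2,
    ← Matrix.mul_assoc]

end IsMoorePenrose

theorem F_zero_implies_G_zero_characterization {m n p s : ℕ}
    (A : Matrix (Fin m) (Fin n) ℂ) (B : Matrix (Fin m) (Fin p) ℂ)
    (C : Matrix (Fin s) (Fin n) ℂ) (D : Matrix (Fin s) (Fin p) ℂ)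
    (Ap : Matrix (Fin n) (Fin m) ℂ) (Bp : Matrix (Fin p) (Fin m) ℂ)
    (Cp : Matrix (Fin n) (Fin s) ℂ) (Dp : Matrix (Fin p) (Fin s) ℂ)
    (hA : IsMoorePenrose A Ap) (hB : IsMoorePenrose B Bp)
    (hC : IsMoorePenrose C Cp) (hD : IsMoorePenrose D Dp)
    (hF : D - C * Ap * B = 0) :
    A - B * Dp * C = 0 ↔
      ((1 - B * Bp) * A = 0 ∧ A * (1 - Cp * C) = 0 ∧
        IsMoorePenrose (C * Ap * B) (Bp * A * Cp)) := by
  obtain rfl : D = C * Ap * B := sub_eq_zero.mp hF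
  constructor
  · intro hG
    have hA' : A = B * Dp * C := sub_eq_zero.mp hG
    obtain ⟨b1, -, -, b4⟩ := hB
    obtain ⟨c1, -, c3, -⟩ := hC
    refine ⟨?_, ?_, ?_⟩
    · rw [Matrix.sub_mul, Matrix.one_mul, sub_eq_zero, hA', ← Matrix.mul_assoc,
        ← Matrix.mul_assoc, b1]
    · rw [Matrix.mul_sub, Matrix.mul_one, sub_eq_zero, hA', Matrix.mul_assoc (B * Dp),
        ← Matrix.mul_assoc C, c1]
    · have hl : (Bp * B) * Dp = Dp :=
        hD.mul_eq_of_mul_eq b4 (by rw [Matrix.mul_assoc, ← Matrix.mul_assoc B, b1])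
      have hr : Dp * (C * Cp) = Dp :=
        hD.eq_mul_of_eq_mul c3 (by rw [← Matrix.mul_assoc, ← Matrix.mul_assoc, c1])
      have h : Bp * A * Cp = Dp := by
        calc Bp * A * Cp = (Bp * B) * Dp * (C * Cp) := by
              rw [hA']; simp only [Matrix.mul_assoc]
          _ = Dp := by rw [hl, hr]
      rwa [h]
  · rintro ⟨h1, h2, h3⟩
    rw [Matrix.sub_mul, Matrix.one_mul, sub_eq_zero] at h1
    rw [Matrix.mul_sub, Matrix.mul_one, sub_eq_zero] at h2
    rw [hD.unique_s3 h3, sub_eq_zero]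
    calc A = (B * Bp) * A * (Cp * C) := by rw [← h1, ← h2]
      _ = B * (Bp * A * Cp) * C := by simp only [Matrix.mul_assoc]
end

section
/- Let A, B, C, D be n×n complex matrices, each group invertible with group inverses A#, B#, C#, D#. If D − C A# B = 0 and A − B D# C = 0, then C# D B# is a {1,2}-inverse of B D# C, i.e. (B D# C)(C# D B#)(B D# C) = B D# C and (C# D B#)(B D# C)(C# D B#) = C# D B#. -/
open Matrix

/-- `X` is the group inverse of `A`. -/
def IsGroupInverse {n : Type*} [Fintype n] (A X : Matrix n n ℂ) : Prop :=
  A * X * A = A ∧ X * A * X = X ∧ A * X = X * A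

theorem vanishing_group_schur_one_two_inverse_BDC {n : ℕ}
    (A B C D Ag Bg Cg Dg : Matrix (Fin n) (Fin n) ℂ)
    (hA : IsGroupInverse A Ag) (hB : IsGroupInverse B Bg)
    (hC : IsGroupInverse C Cg) (hD : IsGroupInverse D Dg)
    (hK : D - C * Ag * B = 0) (hL : A - B * Dg * C = 0) :
    (B * Dg * C) * (Cg * D * Bg) * (B * Dg * C) = B * Dg * C ∧
      (Cg * D * Bg) * (B * Dg * C) * (Cg * D * Bg) = Cg * D * Bg := by
  have hD' : D = C * Ag * B := sub_eq_zero.mp hK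
  have hCD : C * Cg * D = D := by
    rw [hD', ← mul_assoc, ← mul_assoc, hC.1]
  have hDB : D * Bg * B = D := by
    rw [hD', mul_assoc, mul_assoc (C * Ag), ← mul_assoc B, hB.1]
  constructor
  · calc (B * Dg * C) * (Cg * D * Bg) * (B * Dg * C)
        = B * Dg * ((C * Cg * D) * Bg * B) * Dg * C := by simp only [mul_assoc]
      _ = B * (Dg * D * Dg) * C := by rw [hCD, hDB]; simp only [mul_assoc]
      _ = B * Dg * C := by rw [hD.2.1]
  · calc (Cg * D * Bg) * (B * Dg * C) * (Cg * D * Bg)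
        = Cg * ((D * Bg * B) * Dg * (C * Cg * D)) * Bg := by simp only [mul_assoc]
      _ = Cg * D * Bg := by rw [hCD, hDB, hD.1]
end

section
/- Let A, B, C, D be n×n complex matrices, each group invertible with group inverses A#, B#, C#, D#. If D − C A# B = 0 and A − B D# C = 0, then B# A C# is a {1,2}-inverse of C A# B, i.e. (C A# B)(B# A C#)(C A# B) = C A# B and (B# A C#)(C A# B)(B# A C#) = B# A C#. -/
open Matrix

theorem vanishing_group_schur_one_two_inverse_CAB {n : ℕ}
    (A B C D Ag Bg Cg Dg : Matrix (Fin n) (Fin n) ℂ)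
    (hA : IsGroupInverse A Ag) (hB : IsGroupInverse B Bg)
    (hC : IsGroupInverse C Cg) (hD : IsGroupInverse D Dg)
    (hK : D - C * Ag * B = 0) (hL : A - B * Dg * C = 0) :
    (C * Ag * B) * (Bg * A * Cg) * (C * Ag * B) = C * Ag * B ∧
      (Bg * A * Cg) * (C * Ag * B) * (Bg * A * Cg) = Bg * A * Cg := by
  obtain ⟨hA₁, hA₂, -⟩ := hA
  have hA_eq : A = B * Dg * C := sub_eq_zero.mp hL
  have hBA : B * Bg * A = A := by
    rw [hA_eq, Matrix.mul_assoc B Dg C, ← Matrix.mul_assoc (B * Bg), hB.1]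
  have hAC : A * Cg * C = A := by
    rw [hA_eq, Matrix.mul_assoc (B * Dg) C Cg, Matrix.mul_assoc (B * Dg), hC.1]
  constructor
  · calc (C * Ag * B) * (Bg * A * Cg) * (C * Ag * B)
        = C * Ag * ((B * Bg * A) * Cg * C) * Ag * B := by simp only [Matrix.mul_assoc]
      _ = C * (Ag * A * Ag) * B := by rw [hBA, hAC]; simp only [Matrix.mul_assoc]
      _ = C * Ag * B := by rw [hA₂]
  · calc (Bg * A * Cg) * (C * Ag * B) * (Bg * A * Cg)
        = Bg * (A * Cg * C) * Ag * (B * Bg * A) * Cg := by simp only [Matrix.mul_assoc]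
      _ = Bg * (A * Ag * A) * Cg := by rw [hBA, hAC]; simp only [Matrix.mul_assoc]
      _ = Bg * A * Cg := by rw [hA₁]
end

section
/- Let A, B, C, D be n×n complex matrices, each group invertible with group inverses A#, B#, C#, D#. Suppose L = A − B D# C = 0. If K = D − C A# B = 0, then (I − C C#) D = 0, D (I − B# B) = 0, and C# D B# is a {1,2}-inverse of B D# C. -/
open Matrix

theorem L_zero_K_zero_necessary_conditions {n : ℕ}
    (A B C D Ag Bg Cg Dg : Matrix (Fin n) (Fin n) ℂ)
    (hA : IsGroupInverse A Ag) (hB : IsGroupInverse B Bg)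
    (hC : IsGroupInverse C Cg) (hD : IsGroupInverse D Dg)
    (hL : A - B * Dg * C = 0) (hK : D - C * Ag * B = 0) :
    (1 - C * Cg) * D = 0 ∧ D * (1 - Bg * B) = 0 ∧
      ((B * Dg * C) * (Cg * D * Bg) * (B * Dg * C) = B * Dg * C ∧
        (Cg * D * Bg) * (B * Dg * C) * (Cg * D * Bg) = Cg * D * Bg) := by
  have hCD : C * Cg * D = D := by
    rw [sub_eq_zero.mp hK, ← mul_assoc, ← mul_assoc, hC.1]
  have hDB : D * (Bg * B) = D := by
    rw [sub_eq_zero.mp hK, mul_assoc, ← mul_assoc B, hB.1]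
  refine ⟨by rw [sub_mul, one_mul, hCD, sub_self], by rw [mul_sub, mul_one, hDB, sub_self], ?_, ?_⟩
  · calc B * Dg * C * (Cg * D * Bg) * (B * Dg * C)
        = B * Dg * (C * Cg * D * (Bg * B)) * Dg * C := by simp only [mul_assoc]
      _ = B * (Dg * D * Dg) * C := by rw [hCD, hDB]; simp only [mul_assoc]
      _ = B * Dg * C := by rw [hD.2.1]
  · calc Cg * D * Bg * (B * Dg * C) * (Cg * D * Bg)
        = Cg * (D * (Bg * B)) * Dg * (C * Cg * D) * Bg := by simp only [mul_assoc]
      _ = Cg * (D * Dg * D) * Bg := by rw [hCD, hDB]; simp only [mul_assoc]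
      _ = Cg * D * Bg := by rw [hD.1]
end

section
/- Let A, B, C, D be n×n complex matrices, each group invertible with group inverses A#, B#, C#, D#. Suppose K = D − C A# B = 0. If L = A − B D# C = 0, then (I − B B#) A = 0, A (I − C# C) = 0, and B# A C# is a {1,2}-inverse of C A# B. -/
open Matrix

theorem K_zero_L_zero_necessary_conditions {n : ℕ}
    (A B C D Ag Bg Cg Dg : Matrix (Fin n) (Fin n) ℂ)
    (hA : IsGroupInverse A Ag) (hB : IsGroupInverse B Bg)
    (hC : IsGroupInverse C Cg) (hD : IsGroupInverse D Dg)
    (hK : D - C * Ag * B = 0) (hL : A - B * Dg * C = 0) :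
    (1 - B * Bg) * A = 0 ∧ A * (1 - Cg * C) = 0 ∧
      ((C * Ag * B) * (Bg * A * Cg) * (C * Ag * B) = C * Ag * B ∧
        (Bg * A * Cg) * (C * Ag * B) * (Bg * A * Cg) = Bg * A * Cg) := by
  obtain ⟨hA₁, hA₂, -⟩ := hA
  have hA_eq : A = B * Dg * C := sub_eq_zero.mp hL
  have hBA : B * Bg * A = A := by
    rw [hA_eq, ← Matrix.mul_assoc, ← Matrix.mul_assoc, hB.1]
  have hAC : A * Cg * C = A := by
    rw [hA_eq, Matrix.mul_assoc (B * Dg * C), Matrix.mul_assoc (B * Dg), ← Matrix.mul_assoc C,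
      hC.1]
  refine ⟨?_, ?_, ?_, ?_⟩
  · rw [Matrix.sub_mul, Matrix.one_mul, hBA, sub_self]
  · rw [Matrix.mul_sub, Matrix.mul_one, ← Matrix.mul_assoc, hAC, sub_self]
  · calc (C * Ag * B) * (Bg * A * Cg) * (C * Ag * B)
        = C * Ag * (B * Bg * A) * Cg * C * Ag * B := by simp only [Matrix.mul_assoc]
      _ = C * Ag * (A * Cg * C) * Ag * B := by rw [hBA]; simp only [Matrix.mul_assoc]
      _ = C * (Ag * A * Ag) * B := by rw [hAC]; simp only [Matrix.mul_assoc]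
      _ = C * Ag * B := by rw [hA₂]
  · calc (Bg * A * Cg) * (C * Ag * B) * (Bg * A * Cg)
        = Bg * (A * Cg * C) * Ag * (B * Bg * A) * Cg := by simp only [Matrix.mul_assoc]
      _ = Bg * (A * Ag * A) * Cg := by rw [hAC, hBA]; simp only [Matrix.mul_assoc]
      _ = Bg * A * Cg := by rw [hA₁]
end

section
/- Let A, B ∈ ℂ^{m×n} with Moore-Penrose inverses A⁺, B⁺. Then A⁺ + B⁺ = A⁺ (A + B) B⁺ if and only if R(Bᴴ) ⊆ R(Aᴴ) and R(A) ⊆ R(B), where R(X) denotes the column space of X. -/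
open Matrix

/-- The column space (range) of a complex matrix. -/
noncomputable def colSpace {m n : Type*} [Fintype n] (A : Matrix m n ℂ) :
    Submodule ℂ (m → ℂ) :=
  LinearMap.range A.mulVecLin

theorem IsMoorePenrose.conjTranspose {m n : Type*} [Fintype m] [Fintype n]
    {A : Matrix m n ℂ} {X : Matrix n m ℂ} (h : IsMoorePenrose A X) :
    IsMoorePenrose Aᴴ Xᴴ := by
  obtain ⟨h1, h2, h3, h4⟩ := h
  refine ⟨?_, ?_, ?_, ?_⟩
  · rw [← conjTranspose_mul, ← conjTranspose_mul, ← Matrix.mul_assoc, h1]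
  · rw [← conjTranspose_mul, ← conjTranspose_mul, ← Matrix.mul_assoc, h2]
  · rw [← conjTranspose_mul, h4, h4]
  · rw [← conjTranspose_mul, h3, h3]

theorem colSpace_mul_le {m n k : Type*} [Fintype n] [Fintype k]
    (B : Matrix m n ℂ) (C : Matrix n k ℂ) : colSpace (B * C) ≤ colSpace B := by
  rintro _ ⟨v, rfl⟩
  exact ⟨C *ᵥ v, by simp⟩

/-- `B * Y` is a projection onto the column space of `B`. -/
theorem IsMoorePenrose.colSpace_le_iff {m n k : Type*} [Fintype m] [Fintype n] [Fintype k]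
    {B : Matrix m n ℂ} {Y : Matrix n m ℂ} (h : IsMoorePenrose B Y) (C : Matrix m k ℂ) :
    colSpace C ≤ colSpace B ↔ B * Y * C = C := by
  constructor
  · intro hle
    classical
    apply Matrix.ext_of_mulVec_single
    intro i
    obtain ⟨w, hw⟩ := hle ⟨Pi.single i 1, rfl⟩
    simp only [mulVecLin_apply] at hw
    rw [← mulVec_mulVec, ← hw, mulVec_mulVec, h.1]
  · intro hC
    rw [← hC, Matrix.mul_assoc]
    exact colSpace_mul_le _ _

theorem IsMoorePenrose.mul_eq_self_iff {m n : Type*} [Fintype m] [Fintype n]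
    {A : Matrix m n ℂ} {X : Matrix n m ℂ} (h : IsMoorePenrose A X)
    {Q : Matrix m m ℂ} (hQ : Qᴴ = Q) : X * Q = X ↔ Q * A = A := by
  obtain ⟨h1, h2, h3, -⟩ := h
  constructor
  · intro hX
    have hAX : Q * (A * X) = A * X := by
      have := congrArg Matrix.conjTranspose (congrArg (A * ·) hX)
      simpa only [← Matrix.mul_assoc, conjTranspose_mul (A * X) Q, h3, hQ] using this
    calc Q * A = Q * (A * X) * A := by rw [Matrix.mul_assoc, h1]
      _ = A := by rw [hAX, h1]
  · intro hA
    have hAX : A * X * Q = A * X := by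
      have := congrArg Matrix.conjTranspose (congrArg (· * X) hA)
      simpa only [Matrix.mul_assoc Q A X, conjTranspose_mul Q, h3, hQ] using this
    calc X * Q = X * (A * X * Q) := by rw [← Matrix.mul_assoc, ← Matrix.mul_assoc, h2]
      _ = X := by rw [hAX, ← Matrix.mul_assoc, h2]

theorem IsMoorePenrose.absorption_iff {m n : Type*} [Fintype m] [Fintype n]
    {A B : Matrix m n ℂ} {X Y : Matrix n m ℂ}
    (hA : IsMoorePenrose A X) :
    X + Y = X * (A + B) * Y ↔ X * A * Y = Y ∧ X * (B * Y) = X := by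
  have hexp : X * (A + B) * Y = X * A * Y + X * (B * Y) := by
    rw [Matrix.mul_add, Matrix.add_mul, Matrix.mul_assoc X B Y]
  rw [hexp]
  constructor
  · intro h
    have hX : X * (B * Y) = X := by
      have := congrArg (X * A * ·) h
      simp only [Matrix.mul_add, ← Matrix.mul_assoc, hA.2.1] at this
      rw [add_comm X] at this
      rw [← Matrix.mul_assoc]
      exact (add_left_cancel this).symm
    rw [hX, add_comm X] at h
    exact ⟨(add_right_cancel h).symm, hX⟩
  · rintro ⟨h1, h2⟩
    rw [h1, h2, add_comm]

theorem moore_penrose_absorption_law_characterization {m n : ℕ}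
    (A B : Matrix (Fin m) (Fin n) ℂ)
    (Ap Bp : Matrix (Fin n) (Fin m) ℂ)
    (hA : IsMoorePenrose A Ap) (hB : IsMoorePenrose B Bp) :
    Ap + Bp = Ap * (A + B) * Bp ↔
      colSpace Bᴴ ≤ colSpace Aᴴ ∧ colSpace A ≤ colSpace B := by
  have hP : (Aᴴ * Apᴴ : Matrix _ _ ℂ) = Ap * A := by
    rw [← conjTranspose_mul, hA.2.2.2]
  have hBp : Bpᴴ * (Ap * A) = Bpᴴ ↔ Ap * A * Bp = Bp := by
    rw [← conjTranspose_inj, conjTranspose_mul, hA.2.2.2, conjTranspose_conjTranspose]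
  rw [hA.absorption_iff, hA.conjTranspose.colSpace_le_iff, hB.colSpace_le_iff, hP,
    hA.mul_eq_self_iff hB.2.2.1, ← hB.conjTranspose.mul_eq_self_iff hA.2.2.2, hBp]
end

section
/- Let A, B ∈ ℂ^{n×n} be group invertible with group inverses A#, B#. Then A# + B# = A# (A + B) B# if and only if R(Aᴴ) ⊆ R(Bᴴ) and R(B) ⊆ R(A), where R(X) denotes the column space of X. -/
open Matrix

/-- If `X` is an inner inverse of `A`, then the column space of `B` lies in that of `A`
exactly when `A * X` fixes `B`. -/
theorem colSpace_le_iff_mul_eq {m n l : Type*} [Fintype m] [Fintype n] [Fintype l]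
    {A : Matrix m n ℂ} {X : Matrix n m ℂ} (B : Matrix m l ℂ) (h : A * X * A = A) :
    colSpace B ≤ colSpace A ↔ A * X * B = B := by
  constructor
  · intro hle
    classical
    refine Matrix.ext_of_mulVec_single fun i => ?_
    obtain ⟨w, hw⟩ := hle (LinearMap.mem_range_self B.mulVecLin (Pi.single i 1))
    simp only [Matrix.mulVecLin_apply] at hw
    rw [← Matrix.mulVec_mulVec, ← hw, Matrix.mulVec_mulVec, h]
  · rintro hB _ ⟨v, rfl⟩
    refine ⟨X *ᵥ (B *ᵥ v), ?_⟩
    simp only [Matrix.mulVecLin_apply, Matrix.mulVec_mulVec, hB, ← Matrix.mul_assoc]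

/-- The absorption law for elements of a ring with commuting reflexive inner inverses. -/
theorem absorption_law_iff {R : Type*} [Ring R] {a b x y : R}
    (ha : a * x * a = a) (hx : x * a * x = x) (hax : a * x = x * a)
    (hb : b * y * b = b) (hy : y * b * y = y) (hby : b * y = y * b) :
    x + y = x * (a + b) * y ↔ a * (y * b) = a ∧ a * x * b = b := by
  constructor
  · intro h
    have hxy : x * b * y = x := by
      have h' : x * a * (x + y) = x * a * (x * (a + b) * y) := by rw [h]
      have e₁ : x * a * (x + y) = x * a * x + x * a * y := by noncomm_ring
      have e₂ : x * a * (x * (a + b) * y) = x * a * x * a * y + x * a * x * b * y := by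
        noncomm_ring
      rw [e₁, e₂, hx, add_comm] at h'
      exact (add_left_cancel h').symm
    have hyx : x * a * y = y := by
      have e : x * (a + b) * y = x * b * y + x * a * y := by noncomm_ring
      rw [e, hxy] at h
      exact (add_left_cancel h).symm
    have ha' : a * a * x = a := by rw [mul_assoc, hax, ← mul_assoc, ha]
    have hb' : y * b * b = b := by rw [← hby, hb]
    constructor
    · calc a * (y * b) = a * a * x * (b * y) := by rw [ha', hby]
        _ = a * a * (x * b * y) := by noncomm_ring
        _ = a := by rw [hxy, ha']
    · calc a * x * b = x * a * (y * b * b) := by rw [hb', hax]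
        _ = x * a * y * (b * b) := by noncomm_ring
        _ = b := by rw [hyx, ← mul_assoc, hb']
  · rintro ⟨hab, hba⟩
    have hx' : x * x * a = x := by rw [mul_assoc, ← hax, ← mul_assoc, hx]
    have hy' : b * y * y = y := by rw [hby, hy]
    have hxy : x * b * y = x := by
      calc x * b * y = x * x * a * (b * y) := by rw [hx', mul_assoc]
        _ = x * x * (a * (y * b)) := by rw [hby]; noncomm_ring
        _ = x := by rw [hab, hx']
    have hyx : x * a * y = y := by
      calc x * a * y = a * x * (b * y * y) := by rw [hy', hax]
        _ = a * x * b * (y * y) := by noncomm_ring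
        _ = y := by rw [hba, ← mul_assoc, hy']
    rw [mul_add, add_mul, hxy, hyx, add_comm]

theorem group_inverse_absorption_law_characterization {n : ℕ}
    (A B Ag Bg : Matrix (Fin n) (Fin n) ℂ)
    (hA : IsGroupInverse A Ag) (hB : IsGroupInverse B Bg) :
    Ag + Bg = Ag * (A + B) * Bg ↔
      colSpace Aᴴ ≤ colSpace Bᴴ ∧ colSpace B ≤ colSpace A := by
  obtain ⟨ha, hx, hax⟩ := hA
  obtain ⟨hb, hy, hby⟩ := hB
  have hbH : Bᴴ * Bgᴴ * Bᴴ = Bᴴ := by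
    simp only [← Matrix.conjTranspose_mul, ← Matrix.mul_assoc, hb]
  rw [colSpace_le_iff_mul_eq _ ha, colSpace_le_iff_mul_eq _ hbH,
    absorption_law_iff ha hx hax hb hy hby, ← Matrix.conjTranspose_mul,
    ← Matrix.conjTranspose_mul, Matrix.conjTranspose_inj]
end

section
/- Let U = [[A_U, B_U],[C_U, D_U]] and V = [[A_V, B_V],[C_V, D_V]] be complex block matrices with square blocks, where A_U and A_V are group invertible with group inverses A_U#, A_V#, and let K_U = D_U − C_U A_U# B_U and K_V = D_V − C_V A_V# B_V. Suppose K_U and K_V are group invertible, R(B_V) ⊆ R(A_V), R((A_V# B_V)ᴴ) ⊆ R(K_Vᴴ), R(C_Uᴴ) ⊆ R(A_Uᴴ) and R(C_U A_U#) ⊆ R(K_U). If (U, V) is a group inverse absorbing pair, then (K_U, K_V) is also a group inverse absorbing pair. -/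
open Matrix

theorem exists_eq_mul_of_colSpace_le {m n p : Type*} [Fintype n] [Fintype p]
    {A : Matrix m n ℂ} {B : Matrix m p ℂ} (h : colSpace B ≤ colSpace A) :
    ∃ W : Matrix n p ℂ, B = A * W := by
  classical
  have hcol : ∀ j, ∃ w : n → ℂ, A *ᵥ w = B.col j := fun j => by
    have hj : B.col j ∈ colSpace B := ⟨Pi.single j 1, by simp⟩
    simpa [colSpace] using h hj
  choose w hw using hcol
  exact ⟨Matrix.of fun i j => w j i, Matrix.ext fun i j => (congrFun (hw j) i).symm⟩

theorem exists_eq_mul_of_colSpace_conjTranspose_le {m n p : Type*} [Fintype m] [Fintype p]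
    {A : Matrix m n ℂ} {B : Matrix p n ℂ} (h : colSpace Bᴴ ≤ colSpace Aᴴ) :
    ∃ W : Matrix p m ℂ, B = W * A := by
  obtain ⟨W, hW⟩ := exists_eq_mul_of_colSpace_le h
  exact ⟨Wᴴ, by simpa using congrArg conjTranspose hW⟩

/-- Absorption expressed as inclusions of column and row spaces. -/
theorem absorbing_iff {n : Type*} [Fintype n] {U V Ug Vg : Matrix n n ℂ}
    (hU : IsGroupInverse U Ug) (hV : IsGroupInverse V Vg) :
    Ug + Vg = Ug * (U + V) * Vg ↔ (∃ W, V = U * W) ∧ ∃ Z, U = Z * V := by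
  obtain ⟨hU1, hU2, hU3⟩ := hU
  obtain ⟨hV1, hV2, hV3⟩ := hV
  constructor
  · intro h
    have hl : U * Ug * Vg = Vg := by
      have e : U * Ug * (Ug + Vg) = Ug + Vg := by
        rw [h, hU3, ← Matrix.mul_assoc, ← Matrix.mul_assoc, hU2]
      have e' : U * Ug * Ug = Ug := by rw [hU3, hU2]
      rwa [Matrix.mul_add, e', add_right_inj] at e
    have hr : Ug * (V * Vg) = Ug := by
      have e := h
      rw [Matrix.mul_add, Matrix.add_mul, ← hU3, hl, add_comm, add_right_inj,
        Matrix.mul_assoc] at e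
      exact e.symm
    refine ⟨⟨Ug * V, ?_⟩, ⟨U * Vg, ?_⟩⟩
    · calc V = Vg * V * V := by rw [← hV3, hV1]
        _ = U * Ug * Vg * V * V := by rw [hl]
        _ = U * Ug * (Vg * V * V) := by simp only [Matrix.mul_assoc]
        _ = U * (Ug * V) := by rw [← hV3, hV1, Matrix.mul_assoc]
    · calc U = U * (U * Ug) := by rw [hU3, ← Matrix.mul_assoc, hU1]
        _ = U * (U * (Ug * (V * Vg))) := by rw [hr]
        _ = U * (U * Ug) * (V * Vg) := by simp only [Matrix.mul_assoc]
        _ = U * Vg * V := by rw [hU3, ← Matrix.mul_assoc U, hU1, hV3, Matrix.mul_assoc]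
  · rintro ⟨⟨W, hW⟩, ⟨Z, hZ⟩⟩
    have hl : Ug * U * Vg = Vg := by
      have e : Ug * U * V = V := by
        rw [← hU3, hW, ← Matrix.mul_assoc, hU1]
      rw [← hV2, hV3.symm, Matrix.mul_assoc V, ← Matrix.mul_assoc (Ug * U), e]
    have hr : Ug * V * Vg = Ug := by
      have e : U * (V * Vg) = U := by
        rw [hV3, hZ, Matrix.mul_assoc, ← Matrix.mul_assoc V, hV1]
      calc Ug * V * Vg = Ug * U * Ug * (V * Vg) := by rw [hU2, Matrix.mul_assoc]
        _ = Ug * Ug * (U * (V * Vg)) := by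
          rw [Matrix.mul_assoc Ug U Ug, hU3]; simp only [Matrix.mul_assoc]
        _ = Ug := by rw [e, Matrix.mul_assoc, ← hU3, ← Matrix.mul_assoc, hU2]
    rw [Matrix.mul_add, Matrix.add_mul, hl, hr, add_comm]

theorem inheritance_group_schur_group_absorbing {a d : ℕ}
    (AU : Matrix (Fin a) (Fin a) ℂ) (BU : Matrix (Fin a) (Fin d) ℂ)
    (CU : Matrix (Fin d) (Fin a) ℂ) (DU : Matrix (Fin d) (Fin d) ℂ)
    (AV : Matrix (Fin a) (Fin a) ℂ) (BV : Matrix (Fin a) (Fin d) ℂ)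
    (CV : Matrix (Fin d) (Fin a) ℂ) (DV : Matrix (Fin d) (Fin d) ℂ)
    (AUg AVg : Matrix (Fin a) (Fin a) ℂ)
    (hAU : IsGroupInverse AU AUg) (hAV : IsGroupInverse AV AVg)
    (KUg KVg : Matrix (Fin d) (Fin d) ℂ)
    (hKU : IsGroupInverse (DU - CU * AUg * BU) KUg)
    (hKV : IsGroupInverse (DV - CV * AVg * BV) KVg)
    (Ug Vg : Matrix (Fin a ⊕ Fin d) (Fin a ⊕ Fin d) ℂ)
    (hU : IsGroupInverse (Matrix.fromBlocks AU BU CU DU) Ug)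
    (hV : IsGroupInverse (Matrix.fromBlocks AV BV CV DV) Vg)
    (h1 : colSpace BV ≤ colSpace AV)
    (h2 : colSpace (AVg * BV)ᴴ ≤ colSpace (DV - CV * AVg * BV)ᴴ)
    (h3 : colSpace CUᴴ ≤ colSpace AUᴴ)
    (h4 : colSpace (CU * AUg) ≤ colSpace (DU - CU * AUg * BU))
    (habs : Ug + Vg =
      Ug * (Matrix.fromBlocks AU BU CU DU + Matrix.fromBlocks AV BV CV DV) * Vg) :
    KUg + KVg = KUg * ((DU - CU * AUg * BU) + (DV - CV * AVg * BV)) * KVg := by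
  obtain ⟨⟨W, hW⟩, ⟨Z, hZ⟩⟩ := (absorbing_iff hU hV).1 habs
  rw [absorbing_iff hKU hKV]
  obtain ⟨S, hS⟩ := exists_eq_mul_of_colSpace_le h1
  obtain ⟨T, hT⟩ := exists_eq_mul_of_colSpace_conjTranspose_le h2
  obtain ⟨R, hR⟩ := exists_eq_mul_of_colSpace_conjTranspose_le h3
  have hBV : AV * (AVg * BV) = BV := by
    rw [hS, ← Matrix.mul_assoc, ← Matrix.mul_assoc, hAV.1]
  have hCU : CU * AUg * AU = CU := by
    rw [hR, Matrix.mul_assoc R, Matrix.mul_assoc R, hAU.1]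
  rw [← W.fromBlocks_toBlocks, fromBlocks_multiply, fromBlocks_inj] at hW
  rw [← Z.fromBlocks_toBlocks, fromBlocks_multiply, fromBlocks_inj] at hZ
  obtain ⟨hW11, hW12, hW21, hW22⟩ := hW
  obtain ⟨-, hZ12, -, hZ22⟩ := hZ
  constructor
  · set X := W.toBlocks₁₂ - W.toBlocks₁₁ * (AVg * BV) with hX
    set Y := W.toBlocks₂₂ - W.toBlocks₂₁ * (AVg * BV) with hY
    have top : AU * X + BU * Y = 0 := by
      calc AU * X + BU * Y
          = (AU * W.toBlocks₁₂ + BU * W.toBlocks₂₂)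
            - (AU * W.toBlocks₁₁ + BU * W.toBlocks₂₁) * (AVg * BV) := by
            simp only [hX, hY, Matrix.mul_sub, Matrix.add_mul, Matrix.mul_assoc]; abel
        _ = 0 := by rw [← hW11, ← hW12, hBV, sub_self]
    have bot : CU * X + DU * Y = DV - CV * AVg * BV := by
      calc CU * X + DU * Y
          = (CU * W.toBlocks₁₂ + DU * W.toBlocks₂₂)
            - (CU * W.toBlocks₁₁ + DU * W.toBlocks₂₁) * (AVg * BV) := by
            simp only [hX, hY, Matrix.mul_sub, Matrix.add_mul, Matrix.mul_assoc]; abel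
        _ = DV - CV * AVg * BV := by rw [← hW21, ← hW22, Matrix.mul_assoc]
    refine ⟨Y, ?_⟩
    have hCX : CU * X = -(CU * AUg * BU * Y) := by
      rw [← hCU, Matrix.mul_assoc, eq_neg_of_add_eq_zero_left top, hCU]
      simp only [Matrix.mul_neg, Matrix.mul_assoc]
    rw [← bot, hCX, Matrix.sub_mul]
    abel
  · set KV := DV - CV * AVg * BV with hKVdef
    set N := 1 - KVg * KV with hN
    have hKN : KV * N = 0 := by
      rw [hN, Matrix.mul_sub, ← Matrix.mul_assoc, hKV.1, Matrix.mul_one, sub_self]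
    have hAB : AVg * BV * N = 0 := by rw [hT, Matrix.mul_assoc, hKN, Matrix.mul_zero]
    have hB : BV * N = 0 := by rw [← hBV, Matrix.mul_assoc, hAB, Matrix.mul_zero]
    have hD : DV * N = 0 := by
      rwa [hKVdef, Matrix.sub_mul, Matrix.mul_assoc CV, Matrix.mul_assoc CV, hAB,
        Matrix.mul_zero, sub_zero] at hKN
    have hUN : (DU - CU * AUg * BU) * N = 0 := by
      rw [hZ12, hZ22]
      simp only [Matrix.sub_mul, Matrix.add_mul, Matrix.mul_add, Matrix.mul_assoc, hB, hD,
        Matrix.mul_zero, add_zero, sub_zero]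
    rw [hN, Matrix.mul_sub, Matrix.mul_one, sub_eq_zero, ← Matrix.mul_assoc] at hUN
    exact ⟨_, hUN⟩
end
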